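/- Let A, B ∈ ℂ^{n₁×n₁×n₃} with A† = A, B† = B (each tensor equals its own Moore–Penrose inverse), and A ⋆ B = B ⋆ A = O (the zero tensor); let k = max{ind(A), ind(B)} and let A^{GD}, B^{GD} be GD inverses of A and B satisfying the GD equations with exponent k. If A^{GD} ⋆ B = B ⋆ A^{GD} = O and B^{GD} ⋆ A = A ⋆ B^{GD} = O, then the GDMP inverse of A + B built from the GD inverse A^{GD} + B^{GD} satisfies (A+B)^{GD,†} = A^{GD,†} + B^{GD,†}, i.e., (A^{GD}+B^{GD}) ⋆ (A+B) ⋆ (A+B)† = A^{GD}⋆A⋆A† + B^{GD}⋆B⋆B†. -/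

import Mathlib

open Matrix BigOperators

/-- A third-order complex tensor in `ℂ^{n₁ × n₂ × n₃}`, given by its frontal slices. -/
abbrev Tensor3 (n₁ n₂ n₃ : ℕ) := Fin n₃ → Matrix (Fin n₁) (Fin n₂) ℂ

/-- Mode-3 product of a tensor with an `n₃ × n₃` matrix: the slices of the result are the
indicated linear combinations of the slices of `A`. -/
noncomputable def mode3 {n₁ n₂ n₃ : ℕ} (M : Matrix (Fin n₃) (Fin n₃) ℂ) (A : Tensor3 n₁ n₂ n₃) :
    Tensor3 n₁ n₂ n₃ :=
  fun i => ∑ j, M i j • A j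

/-- The M-product `A ⋆_M B`: slice-wise matrix product in the transformed (hat) domain,
transformed back by `M⁻¹`. -/
noncomputable def mprod {n₁ n₂ l n₃ : ℕ} (M : Matrix (Fin n₃) (Fin n₃) ℂ)
    (A : Tensor3 n₁ n₂ n₃) (B : Tensor3 n₂ l n₃) : Tensor3 n₁ l n₃ :=
  mode3 M⁻¹ (fun i => mode3 M A i * mode3 M B i)

/-- The identity tensor: every slice of its mode-3 transform is the identity matrix. -/
noncomputable def idT (n₁ : ℕ) {n₃ : ℕ} (M : Matrix (Fin n₃) (Fin n₃) ℂ) : Tensor3 n₁ n₁ n₃ :=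
  mode3 M⁻¹ (fun _ => (1 : Matrix (Fin n₁) (Fin n₁) ℂ))

/-- Powers of a square tensor with respect to the M-product. -/
noncomputable def mpow {n₁ n₃ : ℕ} (M : Matrix (Fin n₃) (Fin n₃) ℂ) (A : Tensor3 n₁ n₁ n₃) :
    ℕ → Tensor3 n₁ n₁ n₃
  | 0 => idT n₁ M
  | k + 1 => mprod M (mpow M A k) A

/-- Conjugate transpose with respect to the M-product: slice-wise conjugate transpose in the
transformed domain. -/
noncomputable def ctrans {n₁ n₂ n₃ : ℕ} (M : Matrix (Fin n₃) (Fin n₃) ℂ) (A : Tensor3 n₁ n₂ n₃) :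
    Tensor3 n₂ n₁ n₃ :=
  mode3 M⁻¹ (fun i => (mode3 M A i)ᴴ)

/-- Index of a square complex matrix: the least `k ≥ 0` with `rank(B^k) = rank(B^{k+1})`. -/
noncomputable def matIndex {n : ℕ} (B : Matrix (Fin n) (Fin n) ℂ) : ℕ :=
  sInf {k : ℕ | (B ^ k).rank = (B ^ (k + 1)).rank}

/-- Index of a tensor: the maximum of the indices of the slices of its mode-3 transform. -/
noncomputable def tIndex {n₁ n₃ : ℕ} (M : Matrix (Fin n₃) (Fin n₃) ℂ)
    (A : Tensor3 n₁ n₁ n₃) : ℕ :=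
  Finset.univ.sup fun i => matIndex (mode3 M A i)

/-- `X` is a GD inverse of `A` with exponent `k`:
`A ⋆ X ⋆ A = A`, `X ⋆ A^{k+1} = A^k`, `A^{k+1} ⋆ X = A^k`. -/
def IsGD {n₁ n₃ : ℕ} (M : Matrix (Fin n₃) (Fin n₃) ℂ) (A X : Tensor3 n₁ n₁ n₃)
    (k : ℕ) : Prop :=
  mprod M (mprod M A X) A = A ∧
  mprod M X (mpow M A (k + 1)) = mpow M A k ∧
  mprod M (mpow M A (k + 1)) X = mpow M A k

/-- `X` is the Drazin inverse of `A` with exponent `k`. -/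
def IsDrazin {n₁ n₃ : ℕ} (M : Matrix (Fin n₃) (Fin n₃) ℂ) (A X : Tensor3 n₁ n₁ n₃)
    (k : ℕ) : Prop :=
  mprod M X (mpow M A (k + 1)) = mpow M A k ∧
  mprod M (mprod M X A) X = X ∧
  mprod M X A = mprod M A X

/-- `X` is the Moore–Penrose inverse of `A`. -/
def IsMP {n₁ n₃ : ℕ} (M : Matrix (Fin n₃) (Fin n₃) ℂ) (A X : Tensor3 n₁ n₁ n₃) : Prop :=
  mprod M (mprod M A X) A = A ∧
  mprod M (mprod M X A) X = X ∧
  ctrans M (mprod M A X) = mprod M A X ∧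
  ctrans M (mprod M X A) = mprod M X A

theorem mode3_mode3 {n₁ n₂ n₃ : ℕ} (M N : Matrix (Fin n₃) (Fin n₃) ℂ) (A : Tensor3 n₁ n₂ n₃) :
    mode3 M (mode3 N A) = mode3 (M * N) A := by
  funext i
  simp only [mode3, Matrix.mul_apply, Finset.smul_sum, Finset.sum_smul, smul_smul]
  exact Finset.sum_comm

theorem mode3_one {n₁ n₂ n₃ : ℕ} (A : Tensor3 n₁ n₂ n₃) : mode3 1 A = A := by
  funext i
  simp [mode3, Matrix.one_apply]

theorem mode3_add {n₁ n₂ n₃ : ℕ} (M : Matrix (Fin n₃) (Fin n₃) ℂ) (A B : Tensor3 n₁ n₂ n₃) :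
    mode3 M (A + B) = mode3 M A + mode3 M B := by
  funext i
  simp [mode3, Finset.sum_add_distrib]

theorem mode3_zero {n₁ n₂ n₃ : ℕ} (M : Matrix (Fin n₃) (Fin n₃) ℂ) :
    mode3 M (0 : Tensor3 n₁ n₂ n₃) = 0 := by
  funext i
  simp [mode3]

theorem mode3_mode3_inv {n₁ n₂ n₃ : ℕ} {M : Matrix (Fin n₃) (Fin n₃) ℂ} (hM : IsUnit M)
    (A : Tensor3 n₁ n₂ n₃) : mode3 M (mode3 M⁻¹ A) = A := by
  rw [mode3_mode3, Matrix.mul_nonsing_inv _ ((Matrix.isUnit_iff_isUnit_det M).mp hM), mode3_one]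

theorem mode3_injective {n₁ n₂ n₃ : ℕ} {M : Matrix (Fin n₃) (Fin n₃) ℂ} (hM : IsUnit M) :
    Function.Injective (mode3 M : Tensor3 n₁ n₂ n₃ → Tensor3 n₁ n₂ n₃) := by
  refine Function.LeftInverse.injective (g := mode3 M⁻¹) fun A => ?_
  rw [mode3_mode3, Matrix.nonsing_inv_mul _ ((Matrix.isUnit_iff_isUnit_det M).mp hM), mode3_one]

theorem mode3_mprod {n n₃ : ℕ} {M : Matrix (Fin n₃) (Fin n₃) ℂ} (hM : IsUnit M)
    (A B : Tensor3 n n n₃) : mode3 M (mprod M A B) = mode3 M A * mode3 M B :=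
  mode3_mode3_inv hM _

theorem mode3_ctrans {n n₃ : ℕ} {M : Matrix (Fin n₃) (Fin n₃) ℂ} (hM : IsUnit M)
    (A : Tensor3 n n n₃) : mode3 M (ctrans M A) = star (mode3 M A) :=
  mode3_mode3_inv hM _

/-- If `s` is its own Moore–Penrose inverse, then any `{1,3}`-inverse `x` of `s` gives the same
range projection `s * x = s * s`. -/
theorem mul_eq_mul_self_of_isSelfAdjoint {R : Type*} [Semigroup R] [StarMul R] {s x : R}
    (hs : s * s * s = s) (hss : star (s * s) = s * s)
    (hx : s * x * s = s) (hsx : star (s * x) = s * x) : s * x = s * s :=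
  calc s * x = s * s * (s * x) := by rw [← mul_assoc, hs]
    _ = star (s * x * (s * s)) := by rw [star_mul, hss, hsx]
    _ = s * s := by rw [← mul_assoc, hx, hss]

theorem add_mul_add_mul_of_orthogonal {R : Type*} [Ring R] [StarRing R] {a b c d x : R}
    (ha : a * a * a = a) (haa : star (a * a) = a * a)
    (hb : b * b * b = b) (hbb : star (b * b) = b * b)
    (hab : a * b = 0) (hba : b * a = 0) (hcb : c * b = 0) (hda : d * a = 0)
    (hx : (a + b) * x * (a + b) = a + b) (hsx : star ((a + b) * x) = (a + b) * x) :
    (c + d) * (a + b) * x = c * a * a + d * b * b := by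
  have hsq : (a + b) * (a + b) = a * a + b * b := by
    simp [mul_add, add_mul, hab, hba]
  have hcube : (a + b) * (a + b) * (a + b) = a + b := by
    rw [hsq, add_mul, mul_add, mul_add, ha, hb, mul_assoc a a b, hab, mul_assoc b b a, hba]
    simp
  have hstar : star ((a + b) * (a + b)) = (a + b) * (a + b) := by
    rw [hsq, star_add, haa, hbb]
  rw [mul_assoc, mul_eq_mul_self_of_isSelfAdjoint hcube hstar hx hsx, hsq]
  simp [mul_add, add_mul, ← mul_assoc, hcb, hda]

/-- additivity of the GDMP inverse for orthogonal involutory-MP tensors. -/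
theorem gdmp_additivity {n₁ n₃ : ℕ} (hn₁ : 0 < n₁) (hn₃ : 0 < n₃)
    (M : Matrix (Fin n₃) (Fin n₃) ℂ) (hM : IsUnit M)
    (A B AGD BGD Adag Bdag ABdag : Tensor3 n₁ n₁ n₃) (k : ℕ)
    (hAdag : IsMP M A Adag) (hAA : Adag = A)
    (hBdag : IsMP M B Bdag) (hBB : Bdag = B)
    (hAB : mprod M A B = 0) (hBA : mprod M B A = 0)
    (hk : k = max (tIndex M A) (tIndex M B))
    (hAGD : IsGD M A AGD k) (hBGD : IsGD M B BGD k)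
    (h1 : mprod M AGD B = 0) (h2 : mprod M B AGD = 0)
    (h3 : mprod M BGD A = 0) (h4 : mprod M A BGD = 0)
    (hABdag : IsMP M (A + B) ABdag) :
    mprod M (mprod M (AGD + BGD) (A + B)) ABdag =
      mprod M (mprod M AGD A) Adag + mprod M (mprod M BGD B) Bdag := by
  subst hAA hBB
  obtain ⟨hA, -, hA', -⟩ := hAdag
  obtain ⟨hB, -, hB', -⟩ := hBdag
  obtain ⟨hS, -, hS', -⟩ := hABdag
  apply mode3_injective hM
  apply_fun mode3 M at hA hA' hB hB' hS hS' hAB hBA h1 h3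
  simp only [mode3_mprod hM, mode3_ctrans hM, mode3_add, mode3_zero] at *
  exact add_mul_add_mul_of_orthogonal hA hA' hB hB' hAB hBA h1 h3 hS hS'
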